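/- Let λ ∈ ℂ∖ℤ, m ∈ ℕ₀ and fix y ∈ (−1,1). Then the Green's function x ↦ G^m_λ(x,y): (a) is continuous on (−1,1); (b) is smooth on (−1,1)∖{y} and satisfies −λ(λ+1) G^m_λ(x,y) − (L_m G^m_λ(·,y))(x) = 0 for all x ∈ (−1,1) with x ≠ y; and (c) satisfies the jump condition lim_{x→y⁺} ∂_x G^m_λ(x,y) − lim_{x→y⁻} ∂_x G^m_λ(x,y) = −1/(1−y²). -/

import Mathlib

open scoped BigOperators

/-- The Gauss hypergeometric function `₂F₁(a,b;c;x)` as a power series. -/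
noncomputable def hyp2F1 (a b c x : ℂ) : ℂ :=
  ∑' n : ℕ, ((ascPochhammer ℂ n).eval a * (ascPochhammer ℂ n).eval b /
    ((ascPochhammer ℂ n).eval c * (n.factorial : ℂ))) * x ^ n

/-- The associated Legendre function `P^m_λ` of general degree `λ` and order `m ∈ ℕ`. -/
noncomputable def PLeg (m : ℕ) (lam : ℂ) (z : ℝ) : ℂ :=
  ((ascPochhammer ℂ m).eval (-lam) * (ascPochhammer ℂ m).eval (1 + lam) / (m.factorial : ℂ)) *
    (((1 - z) / (1 + z) : ℂ)) ^ ((m : ℂ) / 2) *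
    hyp2F1 (-lam) (lam + 1) (1 + (m : ℂ)) (((1 - z) / 2 : ℝ) : ℂ)

/-- The Green's function `G^m_λ(x,y)` of the operator `-λ(λ+1) - L_m` on `(-1,1)`. -/
noncomputable def Green (m : ℕ) (lam : ℂ) (x y : ℝ) : ℂ :=
  (1 / 2 : ℂ) * Complex.Gamma (1 + lam - m) * Complex.Gamma (-lam - m) *
    (if x ≤ y then PLeg m lam (-x) * PLeg m lam y else PLeg m lam x * PLeg m lam (-y))

open Filter Topology

/-- The power series with coefficients `c` converges on the open unit disc. -/
def ConvOnDisc (c : ℕ → ℂ) : Prop := ∀ z : ℂ, ‖z‖ < 1 → Summable fun n => c n * z ^ n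

/-- The coefficients of the termwise derivative of a power series. -/
def derivCoeff (c : ℕ → ℂ) (n : ℕ) : ℂ := ((n : ℂ) + 1) * c (n + 1)

/-- The sum of the power series with coefficients `c`. -/
noncomputable def powSum (c : ℕ → ℂ) (z : ℂ) : ℂ := ∑' n, c n * z ^ n

lemma hasSum_of_eq {f g : ℕ → ℂ} {s t : ℂ} (h : HasSum f s) (hfg : ∀ n, f n = g n)
    (hst : s = t) : HasSum g t := by
  rwa [← hst, ← funext hfg]

lemma ConvOnDisc.hasSum {c : ℕ → ℂ} (hc : ConvOnDisc c) {z : ℂ} (hz : ‖z‖ < 1) :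
    HasSum (fun n => c n * z ^ n) (powSum c z) := (hc z hz).hasSum

lemma convOnDisc_of_one_le_radius {c : ℕ → ℂ}
    (h : 1 ≤ (FormalMultilinearSeries.ofScalars ℂ c).radius) : ConvOnDisc c := by
  intro z hz
  have h1 : z ∈ Metric.eball (0 : ℂ) (FormalMultilinearSeries.ofScalars ℂ c).radius := by
    refine Metric.eball_subset_eball h ?_
    simpa [Metric.mem_eball, edist_zero_right, enorm_eq_nnnorm, ← NNReal.coe_lt_coe] using hz
  simpa [mul_comm] using
    (FormalMultilinearSeries.ofScalars ℂ c).summable h1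

lemma ConvOnDisc.one_le_radius {c : ℕ → ℂ} (hc : ConvOnDisc c) :
    1 ≤ (FormalMultilinearSeries.ofScalars ℂ c).radius := by
  refine ENNReal.le_of_forall_nnreal_lt fun r hr => ?_
  have hr' : ‖((r : ℝ) : ℂ)‖ < 1 := by simpa using hr
  refine FormalMultilinearSeries.le_radius_of_tendsto _ (l := 0) ?_
  have := (hc _ hr').tendsto_atTop_zero.norm
  simpa [FormalMultilinearSeries.ofScalars_norm] using this

lemma ConvOnDisc.hasFPowerSeriesOnBall {c : ℕ → ℂ} (hc : ConvOnDisc c) :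
    HasFPowerSeriesOnBall (powSum c) (FormalMultilinearSeries.ofScalars ℂ c) 0 1 := by
  have h := (FormalMultilinearSeries.hasFPowerSeriesOnBall (FormalMultilinearSeries.ofScalars ℂ c)
    (lt_of_lt_of_le one_pos hc.one_le_radius)).mono one_pos hc.one_le_radius
  convert h using 1
  ext z
  simp [powSum, FormalMultilinearSeries.sum, mul_comm]

lemma ConvOnDisc.hasSum_deriv {c : ℕ → ℂ} (hc : ConvOnDisc c) {z : ℂ} (hz : ‖z‖ < 1) :
    HasSum (fun n => derivCoeff c n * z ^ n) (deriv (powSum c) z) := by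
  have hz' : z ∈ Metric.eball (0 : ℂ) 1 := by
    simpa [Metric.mem_eball, edist_zero_right, enorm_eq_nnnorm, ← NNReal.coe_lt_coe] using hz
  have h := hc.hasFPowerSeriesOnBall.fderiv.hasSum hz'
  have h2 := h.mapL (ContinuousLinearMap.apply ℂ ℂ (1 : ℂ))
  simp only [ContinuousLinearMap.apply_apply, zero_add, fderiv_apply_one_eq_deriv] at h2
  refine hasSum_of_eq h2 (fun n => ?_) rfl
  have h3 := (FormalMultilinearSeries.ofScalars ℂ c).derivSeries_coeff_one n
  rw [FormalMultilinearSeries.apply_eq_pow_smul_coeff, smul_apply, h3]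
  simp [derivCoeff, FormalMultilinearSeries.coeff_ofScalars]
  ring

lemma ConvOnDisc.deriv_coeff {c : ℕ → ℂ} (hc : ConvOnDisc c) : ConvOnDisc (derivCoeff c) :=
  fun _ hz => (hc.hasSum_deriv hz).summable

lemma ConvOnDisc.analyticAt {c : ℕ → ℂ} (hc : ConvOnDisc c) {z : ℂ} (hz : ‖z‖ < 1) :
    AnalyticAt ℂ (powSum c) z := by
  have hz' : z ∈ Metric.eball (0 : ℂ) 1 := by
    simpa [Metric.mem_eball, edist_zero_right, enorm_eq_nnnorm, ← NNReal.coe_lt_coe] using hz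
  exact hc.hasFPowerSeriesOnBall.analyticAt_of_mem hz'

lemma ConvOnDisc.hasDerivAt {c : ℕ → ℂ} (hc : ConvOnDisc c) {z : ℂ} (hz : ‖z‖ < 1) :
    HasDerivAt (powSum c) (powSum (derivCoeff c) z) z := by
  have h := (hc.analyticAt hz).differentiableAt.hasDerivAt
  rwa [← (hc.hasSum_deriv hz).tsum_eq] at h

lemma ConvOnDisc.hasSum_mul_deriv {c : ℕ → ℂ} (hc : ConvOnDisc c) {z : ℂ} (hz : ‖z‖ < 1) :
    HasSum (fun n : ℕ => (n : ℂ) * c n * z ^ n) (z * powSum (derivCoeff c) z) := by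
  rw [← hasSum_nat_add_iff' 1]
  have h := (hc.deriv_coeff.hasSum hz).mul_left z
  refine hasSum_of_eq h (fun n => ?_) ?_
  · simp only [derivCoeff]; push_cast; ring
  · simp

/-- If the coefficients tend to `L`, then `(1 - x) * ∑ cₙ xⁿ` tends to `L` as `x → 1⁻`. -/
lemma ConvOnDisc.tendsto_one_sub_mul {c : ℕ → ℂ} (hc : ConvOnDisc c) {L : ℂ}
    (hL : Tendsto c atTop (𝓝 L)) :
    Tendsto (fun x : ℝ => (1 - (x : ℂ)) * powSum c x) (𝓝[<] 1) (𝓝 L) := by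
  set f : ℕ → ℂ := fun n => Nat.casesOn n (c 0) fun k => c (k + 1) - c k with hf
  have hsum : ∀ n, ∑ i ∈ Finset.range (n + 1), f i = c n := by
    intro n
    induction n with
    | zero => simp [hf]
    | succ k ih => rw [Finset.sum_range_succ, ih]; simp [hf]
  have h1 : Tendsto (fun n => ∑ i ∈ Finset.range n, f i) atTop (𝓝 L) := by
    rw [← tendsto_add_atTop_iff_nat 1]
    simpa only [hsum] using hL
  have h2 := Complex.tendsto_tsum_powerSeries_nhdsWithin_lt h1
  rw [tendsto_map'_iff] at h2
  refine h2.congr' ?_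
  have hmem : Set.Ioo (0 : ℝ) 1 ∈ 𝓝[<] (1 : ℝ) := Ioo_mem_nhdsLT one_pos
  filter_upwards [hmem] with x hx
  have hx' : ‖(x : ℂ)‖ < 1 := by
    rw [Complex.norm_real, Real.norm_eq_abs, abs_lt]
    exact ⟨by linarith [hx.1], hx.2⟩
  have hs := hc.hasSum hx'
  have hs0 : HasSum (fun n => c (n + 1) * (x : ℂ) ^ (n + 1)) (powSum c x - c 0) := by
    simpa using (hasSum_nat_add_iff' 1).mpr hs
  have hs1 := hs0.sub (hs.mul_left (x : ℂ))
  have hs2 : HasSum (fun n => f n * (x : ℂ) ^ n) ((1 - (x : ℂ)) * powSum c x) := by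
    rw [← hasSum_nat_add_iff' 1]
    refine hasSum_of_eq hs1 (fun n => ?_) ?_
    · simp only [hf]; ring
    · simp [hf]; ring
  exact hs2.tsum_eq

/-- The coefficients of `₂F₁(-λ, λ+1; 1+m; ·)`. -/
noncomputable def legCoeff (m : ℕ) (lam : ℂ) (n : ℕ) : ℂ :=
  (ascPochhammer ℂ n).eval (-lam) * (ascPochhammer ℂ n).eval (lam + 1) /
    ((ascPochhammer ℂ n).eval (1 + (m : ℂ)) * (n.factorial : ℂ))

lemma one_add_natCast_add_natCast_ne_zero (m n : ℕ) : (1 + (m : ℂ) + n) ≠ 0 := by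
  have : ((1 + m + n : ℕ) : ℂ) ≠ 0 := Nat.cast_ne_zero.mpr (by omega)
  simpa using this

lemma eval_ascPochhammer_one_add_ne_zero (m n : ℕ) :
    (ascPochhammer ℂ n).eval (1 + (m : ℂ)) ≠ 0 := by
  intro h
  obtain ⟨k, -, hk⟩ := (ascPochhammer_eval_eq_zero_iff n _).mp h
  exact one_add_natCast_add_natCast_ne_zero m k (by rw [hk]; ring)

lemma legCoeff_zero (m : ℕ) (lam : ℂ) : legCoeff m lam 0 = 1 := by simp [legCoeff]

lemma legCoeff_succ (m : ℕ) (lam : ℂ) (n : ℕ) :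
    legCoeff m lam (n + 1) =
      (n - lam) * (lam + 1 + n) / ((1 + m + n) * (n + 1)) * legCoeff m lam n := by
  have h1 := one_add_natCast_add_natCast_ne_zero m n
  have h2 := eval_ascPochhammer_one_add_ne_zero m n
  have h3 : (n.factorial : ℂ) ≠ 0 := Nat.cast_ne_zero.mpr n.factorial_ne_zero
  have h4 : (n : ℂ) + 1 ≠ 0 := Nat.cast_add_one_ne_zero n
  simp only [legCoeff, ascPochhammer_succ_eval, Nat.factorial_succ, Nat.cast_mul, Nat.cast_add,
    Nat.cast_one]
  field_simp
  ring

lemma legCoeff_succ_order (m : ℕ) (lam : ℂ) (n : ℕ) :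
    legCoeff (m + 1) lam n = (m + 1) / (1 + m + n) * legCoeff m lam n := by
  induction n with
  | zero =>
    have h1 := one_add_natCast_add_natCast_ne_zero m 0
    simp only [legCoeff_zero, Nat.cast_zero, add_zero] at *
    rw [add_comm (m : ℂ) 1, div_self h1, one_mul]
  | succ n ih =>
    have h1 := one_add_natCast_add_natCast_ne_zero m n
    have h2 := one_add_natCast_add_natCast_ne_zero m (n + 1)
    have h3 := one_add_natCast_add_natCast_ne_zero (m + 1) n
    have h4 : (n : ℂ) + 1 ≠ 0 := Nat.cast_add_one_ne_zero n
    rw [legCoeff_succ, legCoeff_succ, ih]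
    push_cast at *
    have h5 : 1 + ((m : ℂ) + 1) + n = 1 + m + (n + 1) := by ring
    rw [h5]
    field_simp

lemma derivCoeff_legCoeff (m : ℕ) (lam : ℂ) (n : ℕ) :
    derivCoeff (legCoeff m lam) n =
      (n - lam) * (lam + 1 + n) / (1 + m + n) * legCoeff m lam n := by
  have h1 := one_add_natCast_add_natCast_ne_zero m n
  have h4 : (n : ℂ) + 1 ≠ 0 := Nat.cast_add_one_ne_zero n
  rw [derivCoeff, legCoeff_succ]
  field_simp

lemma convOnDisc_legCoeff (m : ℕ) {lam : ℂ} (hlam : ∀ n : ℤ, lam ≠ n) :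
    ConvOnDisc (legCoeff m lam) := by
  apply convOnDisc_of_one_le_radius
  have h := ordinaryHypergeometricSeries_radius_eq_one (𝕂 := ℂ) ℂ (-lam) (lam + 1) (1 + (m : ℂ))
    (fun k => ⟨fun hk => hlam k (by push_cast; rw [hk]; ring),
      fun hk => hlam (-k - 1) (by push_cast; rw [hk]; ring),
      fun hk => one_add_natCast_add_natCast_ne_zero m k (by rw [hk]; ring)⟩)
  have hcoeff : ordinaryHypergeometricCoefficient (-lam) (lam + 1) (1 + (m : ℂ)) =
      legCoeff m lam := by
    ext n
    simp only [legCoeff, ordinaryHypergeometricCoefficient, div_eq_mul_inv, mul_inv]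
    ring
  rw [ordinaryHypergeometricSeries, hcoeff] at h
  exact h.ge

/-- The function `₂F₁(-λ, λ+1; 1+m; ·)`. -/
noncomputable def legF (m : ℕ) (lam z : ℂ) : ℂ := powSum (legCoeff m lam) z

/-- The derivative of `legF`. -/
noncomputable def legF' (m : ℕ) (lam z : ℂ) : ℂ := powSum (derivCoeff (legCoeff m lam)) z

/-- The second derivative of `legF`. -/
noncomputable def legF'' (m : ℕ) (lam z : ℂ) : ℂ :=
  powSum (derivCoeff (derivCoeff (legCoeff m lam))) z

section legF

variable (m : ℕ) {lam : ℂ} (hlam : ∀ n : ℤ, lam ≠ n) {z : ℂ} (hz : ‖z‖ < 1)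

include hlam hz

lemma hasDerivAt_legF : HasDerivAt (legF m lam) (legF' m lam z) z :=
  (convOnDisc_legCoeff m hlam).hasDerivAt hz

lemma hasDerivAt_legF' : HasDerivAt (legF' m lam) (legF'' m lam z) z :=
  (convOnDisc_legCoeff m hlam).deriv_coeff.hasDerivAt hz

/-- The hypergeometric differential equation. -/
lemma legF_ode : z * (1 - z) * legF'' m lam z + (1 + m - 2 * z) * legF' m lam z +
    lam * (lam + 1) * legF m lam z = 0 := by
  have hc := convOnDisc_legCoeff m hlam
  have s0 := hc.hasSum hz
  have s1 := hc.deriv_coeff.hasSum hz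
  have s2 := hc.deriv_coeff.hasSum_mul_deriv hz
  have t1 := hc.hasSum_mul_deriv hz
  have t2 := (s2.add s1).mul_left z
  have t2' : HasSum (fun n : ℕ => (n : ℂ) ^ 2 * legCoeff m lam n * z ^ n)
      (z * (z * legF'' m lam z + legF' m lam z)) := by
    rw [← hasSum_nat_add_iff' 1]
    refine hasSum_of_eq t2 (fun n => ?_) ?_
    · simp only [derivCoeff]; push_cast; ring
    · simp [legF', legF'']
  have key := ((s2.add (s1.mul_left (1 + (m : ℂ)))).sub (t2'.add t1)).add
    (s0.mul_left (lam * (lam + 1)))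
  have h0 := key.unique (hasSum_of_eq hasSum_zero (fun n => ?_) rfl)
  · rw [← h0]; simp only [legF, legF', legF'']; ring
  · have h1 := one_add_natCast_add_natCast_ne_zero m n
    rw [derivCoeff_legCoeff]
    field_simp
    ring

lemma legF_succ_order : (m + 1 + lam) * (m - lam) * legF (m + 1) lam z =
    (m + 1) * ((1 - z) * legF' m lam z + m * legF m lam z) := by
  have hc := convOnDisc_legCoeff m hlam
  have hc' := convOnDisc_legCoeff (m + 1) hlam
  have s0 := hc.hasSum hz
  have s1 := hc.deriv_coeff.hasSum hz
  have t1 := hc.hasSum_mul_deriv hz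
  have l := (hc'.hasSum hz).mul_left ((m + 1 + lam) * (m - lam))
  have key := ((s1.sub t1).add (s0.mul_left (m : ℂ))).mul_left ((m : ℂ) + 1)
  refine (l.unique (hasSum_of_eq key (fun n => ?_) rfl)).trans ?_
  · have h1 := one_add_natCast_add_natCast_ne_zero m n
    rw [derivCoeff_legCoeff, legCoeff_succ_order]
    field_simp
    ring
  · simp only [legF, legF']; ring

lemma legF'_succ_order : (m + 1 + lam) * (m - lam) * (z * legF' (m + 1) lam z) =
    -((m + 1) * ((m + 1) * (1 - z) * legF' m lam z + lam * (lam + 1) * legF m lam z)) := by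
  have hc := convOnDisc_legCoeff m hlam
  have hc' := convOnDisc_legCoeff (m + 1) hlam
  have s0 := hc.hasSum hz
  have s1 := hc.deriv_coeff.hasSum hz
  have t1 := hc.hasSum_mul_deriv hz
  have l := (hc'.hasSum_mul_deriv hz).mul_left ((m + 1 + lam) * (m - lam))
  have key := (((s1.sub t1).mul_left ((m : ℂ) + 1)).add
    (s0.mul_left (lam * (lam + 1)))).mul_left (-((m : ℂ) + 1))
  refine (l.unique (hasSum_of_eq key (fun n => ?_) rfl)).trans ?_
  · have h1 := one_add_natCast_add_natCast_ne_zero m n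
    rw [derivCoeff_legCoeff, legCoeff_succ_order]
    field_simp
    ring
  · simp only [legF, legF']; ring

end legF

/-- The normalised Wronskian of `legF m lam x` and `legF m lam (1 - x)`. -/
noncomputable def legWronskian (m : ℕ) (lam z : ℂ) : ℂ :=
  z * (1 - z) * (legF m lam z * legF' m lam (1 - z) + legF' m lam z * legF m lam (1 - z)) +
    m * (legF m lam z * legF m lam (1 - z))

lemma legWronskian_succ (m : ℕ) {lam : ℂ} (hlam : ∀ n : ℤ, lam ≠ n) {z : ℂ} (hz : ‖z‖ < 1)
    (hz' : ‖1 - z‖ < 1) : (m + 1 + lam) * (m - lam) * legWronskian (m + 1) lam z =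
      (m + 1) ^ 2 * legWronskian m lam z := by
  have ha : (m + 1 + lam) * (m - lam) ≠ 0 := by
    refine mul_ne_zero (fun h => hlam (-m - 1) ?_) (fun h => hlam m ?_)
    · push_cast; linear_combination h
    · push_cast; linear_combination -h
  have e1 := legF_succ_order m hlam hz
  have e2 := legF_succ_order m hlam hz'
  have e3 := legF'_succ_order m hlam hz
  have e4 := legF'_succ_order m hlam hz'
  apply mul_left_cancel₀ ha
  simp only [legWronskian]
  push_cast
  generalize legF (m + 1) lam z = g at *
  generalize legF (m + 1) lam (1 - z) = G at *
  generalize legF' (m + 1) lam z = g' at *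
  generalize legF' (m + 1) lam (1 - z) = G' at *
  generalize legF m lam z = u at *
  generalize legF m lam (1 - z) = U at *
  generalize legF' m lam z = v at *
  generalize legF' m lam (1 - z) = V at *
  set a : ℂ := (m + 1 + lam) * (m - lam) with hadef
  have hmain : a * (a * (z * (1 - z) * (g * G' + g' * G) + (m + 1) * (g * G))) =
      z * (a * g) * (a * ((1 - z) * G')) + (1 - z) * (a * G) * (a * (z * g')) +
        (m + 1) * ((a * g) * (a * G)) := by ring
  rw [hmain, e1, e2, e3, e4, hadef]
  ring

lemma norm_ofReal_lt_one {x : ℝ} (hx : x ∈ Set.Ioo (0 : ℝ) 1) : ‖(x : ℂ)‖ < 1 := by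
  rw [Complex.norm_real, Real.norm_eq_abs, abs_lt]
  exact ⟨by linarith [hx.1], hx.2⟩

lemma norm_one_sub_ofReal_lt_one {x : ℝ} (hx : x ∈ Set.Ioo (0 : ℝ) 1) : ‖1 - (x : ℂ)‖ < 1 := by
  have h := norm_ofReal_lt_one (x := 1 - x) ⟨by linarith [hx.2], by linarith [hx.1]⟩
  simpa using h

lemma prod_range_add_eq_ascPochhammer_eval (s : ℂ) (n : ℕ) :
    ∏ j ∈ Finset.range n, (s + j) = (ascPochhammer ℂ n).eval s := by
  induction n with
  | zero => simp
  | succ n ih => rw [Finset.prod_range_succ, ih, ascPochhammer_succ_eval]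

lemma tendsto_derivCoeff_legCoeff_zero {lam : ℂ} (hlam : ∀ n : ℤ, lam ≠ n) :
    Tendsto (derivCoeff (legCoeff 0 lam)) atTop
      (𝓝 (Complex.Gamma (-lam) * Complex.Gamma (1 + lam))⁻¹) := by
  have hG1 : Complex.Gamma (-lam) ≠ 0 := Complex.Gamma_ne_zero fun k hk =>
    hlam k (by push_cast; exact neg_injective hk)
  have hG2 : Complex.Gamma (1 + lam) ≠ 0 := Complex.Gamma_ne_zero fun k hk =>
    hlam (-k - 1) (by push_cast; linear_combination hk)
  have h1 := ((Complex.GammaSeq_tendsto_Gamma (-lam)).mul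
    (Complex.GammaSeq_tendsto_Gamma (1 + lam))).inv₀ (mul_ne_zero hG1 hG2)
  have h2 : Tendsto (fun n : ℕ => (n : ℂ) / ((n : ℂ) + 1)) atTop (𝓝 1) :=
    tendsto_natCast_div_add_atTop (1 : ℂ)
  have h3 := h2.mul h1
  rw [one_mul] at h3
  refine h3.congr' ?_
  filter_upwards [eventually_ne_atTop 0] with n hn
  have hn' : (n : ℂ) ≠ 0 := Nat.cast_ne_zero.mpr hn
  have hn1 : (n : ℂ) + 1 ≠ 0 := Nat.cast_add_one_ne_zero n
  have hf : (n.factorial : ℂ) ≠ 0 := Nat.cast_ne_zero.mpr n.factorial_ne_zero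
  have hp : (n : ℂ) ^ (-lam) * (n : ℂ) ^ (1 + lam) = n := by
    rw [← Complex.cpow_add _ _ hn']; simp
  have hfac : (ascPochhammer ℂ (n + 1)).eval (1 : ℂ) = ((n + 1).factorial : ℂ) := by
    simp
  simp only [Complex.GammaSeq, prod_range_add_eq_ascPochhammer_eval, derivCoeff, legCoeff,
    Nat.cast_zero, add_zero, hfac, add_comm lam 1]
  rw [div_mul_div_comm, inv_div, Nat.factorial_succ,
    show (n : ℂ) ^ (-lam) * n.factorial * ((n : ℂ) ^ (1 + lam) * n.factorial) =
      n * n.factorial ^ 2 by linear_combination (n.factorial : ℂ) ^ 2 * hp]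
  push_cast
  field_simp

lemma tendsto_legCoeff_zero {lam : ℂ} (hlam : ∀ n : ℤ, lam ≠ n) :
    Tendsto (legCoeff 0 lam) atTop (𝓝 0) := by
  rw [← tendsto_add_atTop_iff_nat 1]
  have h := (tendsto_derivCoeff_legCoeff_zero hlam).mul
    (tendsto_one_div_add_atTop_nhds_zero_nat (𝕜 := ℂ))
  rw [mul_zero] at h
  refine h.congr fun n => ?_
  have hn1 : (n : ℂ) + 1 ≠ 0 := Nat.cast_add_one_ne_zero n
  rw [derivCoeff]
  field_simp

lemma hasDerivAt_legWronskian_zero {lam : ℂ} (hlam : ∀ n : ℤ, lam ≠ n) {z : ℂ} (hz : ‖z‖ < 1)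
    (hz' : ‖1 - z‖ < 1) : HasDerivAt (legWronskian 0 lam) 0 z := by
  have a0 := hasDerivAt_legF 0 hlam hz
  have a1 := hasDerivAt_legF' 0 hlam hz
  have hs : HasDerivAt (fun w : ℂ => 1 - w) (-1) z := by
    simpa using (hasDerivAt_id z).const_sub 1
  have b0 := (hasDerivAt_legF 0 hlam hz').comp z hs
  have b1 := (hasDerivAt_legF' 0 hlam hz').comp z hs
  have h := (((hasDerivAt_id z).mul hs).mul ((a0.mul b1).add (a1.mul b0)))
  have hW : legWronskian 0 lam = (id * fun w : ℂ => 1 - w) *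
      (legF 0 lam * (legF' 0 lam ∘ fun w => 1 - w) +
        legF' 0 lam * (legF 0 lam ∘ fun w => 1 - w)) := by
    ext w
    simp [legWronskian]
  rw [hW]
  refine h.congr_deriv ?_
  have o1 := legF_ode 0 hlam hz
  have o2 := legF_ode 0 hlam hz'
  simp only [Pi.mul_apply, Pi.add_apply, Function.comp_apply, id_eq, Nat.cast_zero] at *
  linear_combination legF 0 lam (1 - z) * o1 - legF 0 lam z * o2

lemma legWronskian_zero {lam : ℂ} (hlam : ∀ n : ℤ, lam ≠ n) {x : ℝ}
    (hx : x ∈ Set.Ioo (0 : ℝ) 1) :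
    legWronskian 0 lam x = (Complex.Gamma (-lam) * Complex.Gamma (1 + lam))⁻¹ := by
  have hc := convOnDisc_legCoeff 0 hlam
  have hderiv : ∀ t ∈ Set.Ioo (0 : ℝ) 1,
      HasDerivAt (fun t : ℝ => legWronskian 0 lam t) 0 t := fun t ht =>
    (hasDerivAt_legWronskian_zero hlam (norm_ofReal_lt_one ht)
      (norm_one_sub_ofReal_lt_one ht)).comp_ofReal
  have hconst : ∀ t ∈ Set.Ioo (0 : ℝ) 1, legWronskian 0 lam t = legWronskian 0 lam x :=
    fun t ht => isOpen_Ioo.is_const_of_deriv_eq_zero isPreconnected_Ioo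
      (fun s hs => (hderiv s hs).differentiableAt.differentiableWithinAt)
      (fun s hs => (hderiv s hs).deriv) ht hx
  have hlim1 : Tendsto (fun t : ℝ => legWronskian 0 lam t) (𝓝[<] 1)
      (𝓝 (legWronskian 0 lam x)) := by
    refine tendsto_const_nhds.congr' ?_
    filter_upwards [Ioo_mem_nhdsLT (zero_lt_one' ℝ)] with t ht using (hconst t ht).symm
  have hx1 : Tendsto (fun t : ℝ => (t : ℂ)) (𝓝[<] 1) (𝓝 1) := by
    have := Complex.continuous_ofReal.tendsto 1
    rw [Complex.ofReal_one] at this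
    exact this.mono_left nhdsWithin_le_nhds
  have hx0 : Tendsto (fun t : ℝ => 1 - (t : ℂ)) (𝓝[<] 1) (𝓝 0) := by
    simpa using hx1.const_sub 1
  have hzero : ‖(0 : ℂ)‖ < 1 := by simp
  have l0 : Tendsto (fun t : ℝ => legF 0 lam (1 - t)) (𝓝[<] 1) (𝓝 1) := by
    have h := (hasDerivAt_legF 0 hlam hzero).continuousAt.tendsto.comp hx0
    have h0 : legF 0 lam 0 = 1 := by
      rw [legF, powSum, tsum_eq_single 0 (fun n hn => by simp [hn])]
      simp [legCoeff_zero]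
    rwa [h0] at h
  have l1 : Tendsto (fun t : ℝ => legF' 0 lam (1 - t)) (𝓝[<] 1) (𝓝 (legF' 0 lam 0)) :=
    (hasDerivAt_legF' 0 hlam hzero).continuousAt.tendsto.comp hx0
  have r0 := hc.tendsto_one_sub_mul (tendsto_legCoeff_zero hlam)
  have r1 := hc.deriv_coeff.tendsto_one_sub_mul (tendsto_derivCoeff_legCoeff_zero hlam)
  have hlim2 := hx1.mul ((r0.mul l1).add (r1.mul l0))
  simp only [zero_mul, zero_add, mul_one, one_mul] at hlim2
  refine tendsto_nhds_unique hlim1 (hlim2.congr fun t => ?_)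
  simp only [legWronskian, legF, legF', Nat.cast_zero]
  ring

/-- The leading constant of the associated Legendre function. -/
noncomputable def legConst (m : ℕ) (lam : ℂ) : ℂ :=
  (ascPochhammer ℂ m).eval (-lam) * (ascPochhammer ℂ m).eval (1 + lam) / (m.factorial : ℂ)

lemma gamma_mul_legConst_sq_mul_legWronskian (m : ℕ) {lam : ℂ} (hlam : ∀ n : ℤ, lam ≠ n) {x : ℝ}
    (hx : x ∈ Set.Ioo (0 : ℝ) 1) :
    Complex.Gamma (1 + lam - m) * Complex.Gamma (-lam - m) * legConst m lam ^ 2 *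
      legWronskian m lam x = 1 := by
  induction m with
  | zero =>
    have hG1 : Complex.Gamma (-lam) ≠ 0 := Complex.Gamma_ne_zero fun k hk =>
      hlam k (by push_cast; exact neg_injective hk)
    have hG2 : Complex.Gamma (1 + lam) ≠ 0 := Complex.Gamma_ne_zero fun k hk =>
      hlam (-k - 1) (by push_cast; linear_combination hk)
    rw [legWronskian_zero hlam hx]
    simp [legConst]
    field_simp
  | succ m ih =>
    have ha : lam - m ≠ 0 := fun h => hlam m (by push_cast; linear_combination h)
    have hb : lam + m + 1 ≠ 0 := fun h => hlam (-m - 1) (by push_cast; linear_combination h)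
    have hm : (m : ℂ) + 1 ≠ 0 := Nat.cast_add_one_ne_zero m
    have hf : (m.factorial : ℂ) ≠ 0 := Nat.cast_ne_zero.mpr m.factorial_ne_zero
    have g1 : Complex.Gamma (1 + lam - m) = (lam - m) * Complex.Gamma (lam - m) := by
      rw [← Complex.Gamma_add_one _ ha]; congr 1; ring
    have g2 : Complex.Gamma (-lam - m) =
        (-lam - m - 1) * Complex.Gamma (-lam - m - 1) := by
      rw [← Complex.Gamma_add_one _ (fun h => hb (by linear_combination -h))]; congr 1; ring
    have hC : legConst (m + 1) lam =
        legConst m lam * ((m - lam) * (1 + lam + m)) / (m + 1) := by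
      simp only [legConst, ascPochhammer_succ_eval, Nat.factorial_succ]
      push_cast
      field_simp
      ring
    have hW := legWronskian_succ m hlam (norm_ofReal_lt_one hx) (norm_one_sub_ofReal_lt_one hx)
    rw [g1, g2] at ih
    rw [hC]
    push_cast
    rw [show 1 + lam - ((m : ℂ) + 1) = lam - m by ring,
      show -lam - ((m : ℂ) + 1) = -lam - m - 1 by ring]
    refine Eq.trans ?_ ih
    rw [mul_div_assoc, mul_pow, div_pow]
    field_simp
    linear_combination Complex.Gamma (lam - m) * Complex.Gamma (-lam - m - 1) *
      legConst m lam ^ 2 * (m - lam) * (1 + lam + m) * hW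

/-- The factor `((1-z)/(1+z))^{m/2}` of the associated Legendre function. -/
noncomputable def legFactor (m : ℕ) (z : ℝ) : ℂ := (((1 - z) / (1 + z) : ℂ)) ^ ((m : ℂ) / 2)

section interval

variable {z : ℝ} (hz : z ∈ Set.Ioo (-1 : ℝ) 1)

include hz

lemma half_one_sub_mem : (1 - z) / 2 ∈ Set.Ioo (0 : ℝ) 1 :=
  ⟨by linarith [hz.2], by linarith [hz.1]⟩

lemma neg_mem_Ioo_neg_one_one : -z ∈ Set.Ioo (-1 : ℝ) 1 :=
  ⟨by linarith [hz.2], by linarith [hz.1]⟩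

lemma one_sub_ofReal_ne_zero : 1 - (z : ℂ) ≠ 0 := by
  rw [← Complex.ofReal_one, ← Complex.ofReal_sub, Complex.ofReal_ne_zero]
  linarith [hz.2]

lemma one_add_ofReal_ne_zero : 1 + (z : ℂ) ≠ 0 := by
  rw [← Complex.ofReal_one, ← Complex.ofReal_add, Complex.ofReal_ne_zero]
  linarith [hz.1]

lemma one_sub_ofReal_sq_ne_zero : 1 - (z : ℂ) ^ 2 ≠ 0 := by
  rw [show 1 - (z : ℂ) ^ 2 = (1 - z) * (1 + z) by ring]
  exact mul_ne_zero (one_sub_ofReal_ne_zero hz) (one_add_ofReal_ne_zero hz)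

lemma one_sub_div_one_add_mem_slitPlane : (1 - (z : ℂ)) / (1 + z) ∈ Complex.slitPlane := by
  have h : (1 - (z : ℂ)) / (1 + z) = ((1 - z) / (1 + z) : ℝ) := by push_cast; rfl
  rw [h, Complex.ofReal_mem_slitPlane]
  exact div_pos (by linarith [hz.2]) (by linarith [hz.1])

lemma legFactor_mul_legFactor_neg (m : ℕ) : legFactor m z * legFactor m (-z) = 1 := by
  have h1 := one_sub_ofReal_ne_zero hz
  have h2 := one_add_ofReal_ne_zero hz
  have hinv : (1 - ((-z : ℝ) : ℂ)) / (1 + ((-z : ℝ) : ℂ)) = ((1 - (z : ℂ)) / (1 + z))⁻¹ := by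
    push_cast
    rw [inv_div]
    congr 1
    ring
  rw [legFactor, legFactor, hinv, Complex.inv_cpow _ _
    (Complex.slitPlane_arg_ne_pi (one_sub_div_one_add_mem_slitPlane hz))]
  refine mul_inv_cancel₀ ?_
  rw [Complex.cpow_ne_zero_iff]
  exact Or.inl (div_ne_zero h1 h2)

lemma hasDerivAt_legFactor (m : ℕ) :
    HasDerivAt (legFactor m) (-(m / (1 - (z : ℂ) ^ 2)) * legFactor m z) z := by
  have h1 := one_sub_ofReal_ne_zero hz
  have h2 := one_add_ofReal_ne_zero hz
  have h3 := one_sub_ofReal_sq_ne_zero hz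
  have hn : HasDerivAt (fun w : ℂ => 1 - w) (-1) z := by
    simpa using (hasDerivAt_id (z : ℂ)).const_sub 1
  have hd : HasDerivAt (fun w : ℂ => 1 + w) 1 z := by
    simpa using (hasDerivAt_id (z : ℂ)).const_add 1
  have h := (((hn.fun_div hd h2).cpow_const (c := (m : ℂ) / 2)
    (one_sub_div_one_add_mem_slitPlane hz))).comp_ofReal
  refine h.congr_deriv ?_
  rw [Complex.cpow_sub _ _ (div_ne_zero h1 h2), Complex.cpow_one, legFactor]
  rw [show 1 - (z : ℂ) ^ 2 = (1 - z) * (1 + z) by ring]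
  field_simp
  ring

lemma contDiffAt_legFactor (m : ℕ) : ContDiffAt ℝ (⊤ : ℕ∞) (legFactor m) z := by
  have hr : AnalyticAt ℂ (fun w : ℂ => (1 - w) / (1 + w)) z :=
    (analyticAt_const.sub analyticAt_id).div (analyticAt_const.add analyticAt_id)
      (one_add_ofReal_ne_zero hz)
  have h := hr.cpow (analyticAt_const (v := (m : ℂ) / 2)) (one_sub_div_one_add_mem_slitPlane hz)
  exact (h.contDiffAt.restrict_scalars ℝ).comp z Complex.ofRealCLM.contDiff.contDiffAt

variable (m : ℕ) {lam : ℂ} (hlam : ∀ n : ℤ, lam ≠ n)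

omit hz in
lemma PLeg_eq (lam : ℂ) (z : ℝ) :
    PLeg m lam z = legConst m lam * legFactor m z * legF m lam ((1 - z) / 2) := by
  simp only [PLeg, legConst, legFactor, legF, powSum, hyp2F1, legCoeff]
  push_cast
  rfl

lemma norm_half_one_sub_lt_one : ‖(1 - (z : ℂ)) / 2‖ < 1 := by
  simpa using norm_ofReal_lt_one (half_one_sub_mem hz)

include hlam

lemma contDiffAt_PLeg : ContDiffAt ℝ (⊤ : ℕ∞) (PLeg m lam) z := by
  have hF : AnalyticAt ℂ (fun w : ℂ => legF m lam ((1 - w) / 2)) z := by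
    have h := (convOnDisc_legCoeff m hlam).analyticAt (norm_half_one_sub_lt_one hz)
    exact h.comp_of_eq (f := fun w : ℂ => (1 - w) / 2)
      ((analyticAt_const.sub analyticAt_id).div analyticAt_const two_ne_zero) rfl
  have hF' : ContDiffAt ℝ (⊤ : ℕ∞) (fun w : ℝ => legF m lam ((1 - w) / 2)) z :=
    (hF.contDiffAt.restrict_scalars ℝ).comp z Complex.ofRealCLM.contDiff.contDiffAt
  rw [funext (PLeg_eq m lam)]
  exact (contDiffAt_const.mul (contDiffAt_legFactor hz m)).mul hF'

end interval

/-- The derivative of the associated Legendre function. -/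
noncomputable def PLegDeriv (m : ℕ) (lam : ℂ) (z : ℝ) : ℂ :=
  -(legConst m lam * legFactor m z * (m / (1 - (z : ℂ) ^ 2) * legF m lam ((1 - z) / 2) +
    legF' m lam ((1 - z) / 2) / 2))

section interval

variable {z : ℝ} (hz : z ∈ Set.Ioo (-1 : ℝ) 1) (m : ℕ) {lam : ℂ} (hlam : ∀ n : ℤ, lam ≠ n)

include hz hlam

lemma hasDerivAt_legF_half : HasDerivAt (fun w : ℝ => legF m lam ((1 - w) / 2))
    (-(legF' m lam ((1 - z) / 2) / 2)) z := by
  have hs : HasDerivAt (fun w : ℂ => (1 - w) / 2) (-1 / 2) z := by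
    simpa using ((hasDerivAt_id (z : ℂ)).const_sub 1).div_const 2
  have h := ((hasDerivAt_legF m hlam (norm_half_one_sub_lt_one hz)).comp (z : ℂ) hs).comp_ofReal
  exact h.congr_deriv (by ring)

lemma hasDerivAt_legF'_half : HasDerivAt (fun w : ℝ => legF' m lam ((1 - w) / 2))
    (-(legF'' m lam ((1 - z) / 2) / 2)) z := by
  have hs : HasDerivAt (fun w : ℂ => (1 - w) / 2) (-1 / 2) z := by
    simpa using ((hasDerivAt_id (z : ℂ)).const_sub 1).div_const 2
  have h := ((hasDerivAt_legF' m hlam (norm_half_one_sub_lt_one hz)).comp (z : ℂ) hs).comp_ofReal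
  exact h.congr_deriv (by ring)

lemma hasDerivAt_PLeg : HasDerivAt (PLeg m lam) (PLegDeriv m lam z) z := by
  have h := ((hasDerivAt_legFactor hz m).const_mul (legConst m lam)).fun_mul
    (hasDerivAt_legF_half hz m hlam)
  rw [funext (PLeg_eq m lam)]
  refine h.congr_deriv ?_
  rw [PLegDeriv]
  ring

/-- The associated Legendre equation. -/
lemma hasDerivAt_one_sub_sq_mul_PLegDeriv :
    HasDerivAt (fun w : ℝ => (1 - (w : ℂ) ^ 2) * PLegDeriv m lam w)
      ((m ^ 2 / (1 - (z : ℂ) ^ 2) - lam * (lam + 1)) * PLeg m lam z) z := by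
  have h3 := one_sub_ofReal_sq_ne_zero hz
  have hq : HasDerivAt (fun w : ℝ => (1 - (w : ℂ) ^ 2) / 2) (-(z : ℂ)) z := by
    have h := ((((hasDerivAt_id (z : ℂ)).pow 2).const_sub 1).div_const 2).comp_ofReal
    refine h.congr_deriv ?_
    simp
    ring
  have h := (((hasDerivAt_legFactor hz m).const_mul (legConst m lam)).fun_mul
    (((hasDerivAt_legF_half hz m hlam).const_mul (m : ℂ)).fun_add
      (hq.fun_mul (hasDerivAt_legF'_half hz m hlam)))).neg
  have heq : (fun w : ℝ => (1 - (w : ℂ) ^ 2) * PLegDeriv m lam w) =ᶠ[𝓝 z]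
      -fun w : ℝ => legConst m lam * legFactor m w * (m * legF m lam ((1 - w) / 2) +
        (1 - (w : ℂ) ^ 2) / 2 * legF' m lam ((1 - w) / 2)) := by
    filter_upwards [isOpen_Ioo.mem_nhds hz] with w hw
    have hw3 := one_sub_ofReal_sq_ne_zero hw
    simp only [PLegDeriv, Pi.neg_apply]
    field_simp
  refine (h.congr_of_eventuallyEq heq).congr_deriv ?_
  have ode := legF_ode m hlam (norm_half_one_sub_lt_one hz)
  rw [PLeg_eq]
  generalize legF m lam ((1 - z) / 2) = f at *
  generalize legF' m lam ((1 - z) / 2) = f' at *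
  generalize legF'' m lam ((1 - z) / 2) = f'' at *
  field_simp
  linear_combination 4 * (legConst m lam * legFactor m z) * (1 - (z : ℂ) ^ 2) * ode

lemma continuousAt_PLegDeriv : ContinuousAt (PLegDeriv m lam) z := by
  have h3 := one_sub_ofReal_sq_ne_zero hz
  have h1 : ContinuousAt (fun w : ℝ => 1 - (w : ℂ) ^ 2) z := by fun_prop
  exact (((hasDerivAt_legFactor hz m).continuousAt.const_mul (legConst m lam)).mul
    (((continuousAt_const.div h1 h3).mul (hasDerivAt_legF_half hz m hlam).continuousAt).add
      ((hasDerivAt_legF'_half hz m hlam).continuousAt.div_const 2))).neg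

lemma hasDerivAt_PLeg_neg :
    HasDerivAt (fun w => PLeg m lam (-w)) (-PLegDeriv m lam (-z)) z := by
  have h := (hasDerivAt_PLeg (neg_mem_Ioo_neg_one_one hz) m hlam).scomp z (hasDerivAt_neg z)
  exact h.congr_deriv (by simp)

lemma hasDerivAt_one_sub_sq_mul_PLegDeriv_neg :
    HasDerivAt (fun w : ℝ => (1 - (w : ℂ) ^ 2) * -PLegDeriv m lam (-w))
      ((m ^ 2 / (1 - (z : ℂ) ^ 2) - lam * (lam + 1)) * PLeg m lam (-z)) z := by
  have h := ((hasDerivAt_one_sub_sq_mul_PLegDeriv (neg_mem_Ioo_neg_one_one hz) m hlam).scomp z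
    (hasDerivAt_neg z)).neg
  simp only [Complex.ofReal_neg, neg_sq, neg_smul, one_smul, neg_neg] at h
  refine h.congr_of_eventuallyEq (Eventually.of_forall fun w => ?_)
  simp [Function.comp_def]

/-- The Wronskian of `z ↦ P(z)` and `z ↦ P(-z)`. -/
lemma gamma_mul_PLeg_wronskian :
    1 / 2 * Complex.Gamma (1 + lam - m) * Complex.Gamma (-lam - m) *
      (PLegDeriv m lam z * PLeg m lam (-z) + PLegDeriv m lam (-z) * PLeg m lam z) =
        -(1 / (1 - (z : ℂ) ^ 2)) := by
  have h3 := one_sub_ofReal_sq_ne_zero hz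
  have hW := gamma_mul_legConst_sq_mul_legWronskian m hlam (half_one_sub_mem hz)
  have hR := legFactor_mul_legFactor_neg hz m
  rw [legWronskian] at hW
  rw [PLeg_eq, PLeg_eq, PLegDeriv, PLegDeriv]
  push_cast at *
  rw [show 1 - (1 - (z : ℂ)) / 2 = (1 - -z) / 2 by ring] at hW
  rw [neg_sq]
  generalize legF m lam ((1 - z) / 2) = f at *
  generalize legF m lam ((1 - -z) / 2) = g at *
  generalize legF' m lam ((1 - z) / 2) = f' at *
  generalize legF' m lam ((1 - -z) / 2) = g' at *
  generalize legFactor m z = r at *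
  generalize legFactor m (-z) = s at *
  generalize Complex.Gamma (1 + lam - m) = A at *
  generalize Complex.Gamma (-lam - m) = B at *
  generalize legConst m lam = C at *
  field_simp
  linear_combination -4 * hW - A * B * C ^ 2 * (f * g' * (1 - z ^ 2) + g * f' * (1 - z ^ 2) +
    4 * m * f * g) * hR

end interval

theorem green_function_properties (m : ℕ) (lam : ℂ) (hlam : ∀ n : ℤ, lam ≠ (n : ℂ))
    (y : ℝ) (hy : y ∈ Set.Ioo (-1 : ℝ) 1) :
    ContinuousOn (fun x : ℝ => Green m lam x y) (Set.Ioo (-1 : ℝ) 1) ∧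
    ContDiffOn ℝ (⊤ : ℕ∞) (fun x : ℝ => Green m lam x y) (Set.Ioo (-1 : ℝ) 1 \ {y}) ∧
    (∀ x ∈ Set.Ioo (-1 : ℝ) 1, x ≠ y →
      -(lam * (lam + 1)) * Green m lam x y -
        (deriv (fun t : ℝ => ((1 - t ^ 2 : ℝ) : ℂ) *
            deriv (fun s : ℝ => Green m lam s y) t) x
          - ((m : ℂ) ^ 2 / (1 - (x : ℂ) ^ 2)) * Green m lam x y) = 0) ∧
    ∃ A B : ℂ,
      Filter.Tendsto (fun x : ℝ => deriv (fun s : ℝ => Green m lam s y) x)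
        (nhdsWithin y (Set.Ioi y)) (nhds A) ∧
      Filter.Tendsto (fun x : ℝ => deriv (fun s : ℝ => Green m lam s y) x)
        (nhdsWithin y (Set.Iio y)) (nhds B) ∧
      A - B = -(1 / (1 - (y : ℂ) ^ 2)) := by
  set K : ℂ := 1 / 2 * Complex.Gamma (1 + lam - m) * Complex.Gamma (-lam - m) with hK
  have hleft : ∀ t : ℝ, t ≤ y → Green m lam t y = K * PLeg m lam y * PLeg m lam (-t) := by
    intro t ht
    rw [Green, if_pos ht]
    ring
  have hright : ∀ t : ℝ, y ≤ t → Green m lam t y = K * PLeg m lam (-y) * PLeg m lam t := by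
    intro t ht
    rcases ht.eq_or_lt with rfl | ht
    · rw [hleft y le_rfl]
      ring
    · rw [Green, if_neg ht.not_ge]
      ring
  have hleft' : ∀ t < y, (fun s : ℝ => Green m lam s y) =ᶠ[𝓝 t]
      fun s => K * PLeg m lam y * PLeg m lam (-s) := fun t ht => by
    filter_upwards [Iio_mem_nhds ht] with s hs using hleft s (le_of_lt hs)
  have hright' : ∀ t > y, (fun s : ℝ => Green m lam s y) =ᶠ[𝓝 t]
      fun s => K * PLeg m lam (-y) * PLeg m lam s := fun t ht => by
    filter_upwards [Ioi_mem_nhds ht] with s hs using hright s (le_of_lt hs)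
  have hderivLeft : ∀ t ∈ Set.Ioo (-1 : ℝ) 1, t < y → deriv (fun s : ℝ => Green m lam s y) t =
      K * PLeg m lam y * -PLegDeriv m lam (-t) := fun t ht hty => by
    rw [(hleft' t hty).deriv_eq]
    exact ((hasDerivAt_PLeg_neg ht m hlam).const_mul _).deriv
  have hderivRight : ∀ t ∈ Set.Ioo (-1 : ℝ) 1, y < t → deriv (fun s : ℝ => Green m lam s y) t =
      K * PLeg m lam (-y) * PLegDeriv m lam t := fun t ht hty => by
    rw [(hright' t hty).deriv_eq]
    exact ((hasDerivAt_PLeg ht m hlam).const_mul _).deriv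
  have hsmooth : ∀ x ∈ Set.Ioo (-1 : ℝ) 1, x ≠ y →
      ContDiffAt ℝ (⊤ : ℕ∞) (fun x : ℝ => Green m lam x y) x := by
    intro x hx hxy
    rcases hxy.lt_or_gt with h | h
    · refine ContDiffAt.congr_of_eventuallyEq ?_ (hleft' x h)
      exact contDiffAt_const.mul
        ((contDiffAt_PLeg (neg_mem_Ioo_neg_one_one hx) m hlam).comp x contDiff_neg.contDiffAt)
    · exact (contDiffAt_const.mul (contDiffAt_PLeg hx m hlam)).congr_of_eventuallyEq (hright' x h)
  refine ⟨fun x hx => ?_, fun x hx => (hsmooth x hx.1 hx.2).contDiffWithinAt, fun x hx hxy => ?_,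
    K * PLeg m lam (-y) * PLegDeriv m lam y, K * PLeg m lam y * -PLegDeriv m lam (-y), ?_, ?_, ?_⟩
  · by_cases hxy : x = y
    · subst hxy
      refine ContinuousAt.continuousWithinAt
        (continuousAt_iff_continuous_left_right.mpr ⟨?_, ?_⟩)
      · exact ((hasDerivAt_PLeg_neg hx m hlam).const_mul (K * PLeg m lam x)).continuousAt
          |>.continuousWithinAt.congr (fun t ht => hleft t ht) (hleft x le_rfl)
      · exact ((hasDerivAt_PLeg hx m hlam).const_mul (K * PLeg m lam (-x))).continuousAt
          |>.continuousWithinAt.congr (fun t ht => hright t ht) (hright x le_rfl)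
    · exact (hsmooth x hx hxy).continuousAt.continuousWithinAt
  · rcases hxy.lt_or_gt with h | h
    · have heq : (fun t : ℝ => ((1 - t ^ 2 : ℝ) : ℂ) * deriv (fun s : ℝ => Green m lam s y) t)
          =ᶠ[𝓝 x] fun t => K * PLeg m lam y * ((1 - (t : ℂ) ^ 2) * -PLegDeriv m lam (-t)) := by
        filter_upwards [isOpen_Ioo.mem_nhds hx, Iio_mem_nhds h] with t ht hty
        rw [hderivLeft t ht hty]
        push_cast
        ring
      rw [heq.deriv_eq, hleft x h.le,
        ((hasDerivAt_one_sub_sq_mul_PLegDeriv_neg hx m hlam).const_mul _).deriv]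
      ring
    · have heq : (fun t : ℝ => ((1 - t ^ 2 : ℝ) : ℂ) * deriv (fun s : ℝ => Green m lam s y) t)
          =ᶠ[𝓝 x] fun t => K * PLeg m lam (-y) * ((1 - (t : ℂ) ^ 2) * PLegDeriv m lam t) := by
        filter_upwards [isOpen_Ioo.mem_nhds hx, Ioi_mem_nhds h] with t ht hty
        rw [hderivRight t ht hty]
        push_cast
        ring
      rw [heq.deriv_eq, hright x h.le,
        ((hasDerivAt_one_sub_sq_mul_PLegDeriv hx m hlam).const_mul _).deriv]
      ring
  · have hc := (continuousAt_PLegDeriv hy m hlam).tendsto.const_mul (K * PLeg m lam (-y))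
    refine (hc.mono_left nhdsWithin_le_nhds).congr' ?_
    filter_upwards [self_mem_nhdsWithin, mem_nhdsWithin_of_mem_nhds (isOpen_Ioo.mem_nhds hy)]
      with t hty ht using (hderivRight t ht hty).symm
  · have hc := (((continuousAt_PLegDeriv (neg_mem_Ioo_neg_one_one hy) m hlam).tendsto.comp
      (continuous_neg.tendsto y)).neg).const_mul (K * PLeg m lam y)
    refine (hc.mono_left nhdsWithin_le_nhds).congr' ?_
    filter_upwards [self_mem_nhdsWithin, mem_nhdsWithin_of_mem_nhds (isOpen_Ioo.mem_nhds hy)]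
      with t hty ht using (hderivLeft t ht hty).symm
  · rw [← gamma_mul_PLeg_wronskian hy m hlam]
    ring
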